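/- For every integer n ≥ 0 and every real s > −1, the Laplace transform of the Bateman function of order 2n+2 is ∫₀^∞ e^{−s t} k_{2n+2}(t) dt = 2(1 − s)^n / (s + 1)^{n+2}. -/

import Mathlib

/-- The Bateman function `k_ν(x) = (2/π) ∫₀^{π/2} cos(x·tan θ − ν·θ) dθ`. -/
noncomputable def batemanK (ν x : ℝ) : ℝ :=
  (2 / Real.pi) * ∫ θ in (0:ℝ)..(Real.pi / 2), Real.cos (x * Real.tan θ - ν * θ)

open MeasureTheory Set
open scoped FourierTransform

/-- The polynomial factor of the Bateman function: `k_{2n+2}(t) = batemanPoly n t * exp (-t)` for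
`t > 0`. -/
noncomputable def batemanPoly (n : ℕ) (t : ℝ) : ℝ :=
  ∑ j ∈ Finset.range (n + 1),
    2 * (2 ^ j * (-1) ^ (n - j) * (n.choose j : ℝ)) / ((j + 1).factorial : ℝ) * t ^ (j + 1)

lemma batemanPoly_zero (n : ℕ) : batemanPoly n 0 = 0 := by
  simp [batemanPoly]

lemma continuous_batemanPoly (n : ℕ) : Continuous (batemanPoly n) := by
  unfold batemanPoly
  fun_prop

lemma integrableOn_pow_mul_cexp_neg_mul_Ioi (k : ℕ) {r : ℂ} (hr : 0 < r.re) :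
    IntegrableOn (fun t : ℝ ↦ (t : ℂ) ^ k * Complex.exp (-(r * t))) (Ioi 0) := by
  have h : IntegrableOn (fun t : ℝ ↦ t ^ (k : ℝ) * Real.exp (-r.re * t ^ (1 : ℝ))) (Ioi 0) :=
    integrableOn_rpow_mul_exp_neg_mul_rpow (by linarith [k.cast_nonneg (α := ℝ)]) one_pos hr
  refine h.mono' (Continuous.aestronglyMeasurable (by fun_prop)) ?_
  filter_upwards [ae_restrict_mem measurableSet_Ioi] with t ht
  have ht : 0 < t := ht
  simp [Complex.norm_exp, abs_of_pos ht]

lemma integral_pow_mul_cexp_neg_mul_Ioi (k : ℕ) {r : ℂ} (hr : 0 < r.re) :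
    ∫ t in Ioi (0 : ℝ), (t : ℂ) ^ k * Complex.exp (-(r * t)) = k.factorial / r ^ (k + 1) := by
  have hr0 : r ≠ 0 := by
    rintro rfl
    simp at hr
  induction k with
  | zero =>
    have h := integral_exp_mul_complex_Ioi (a := -r) (by simpa using hr) 0
    simpa [neg_div_neg_eq] using h
  | succ k ih =>
    have hd : ∀ t ∈ Ici (0 : ℝ), HasDerivAt
        (fun t : ℝ ↦ (t : ℂ) ^ (k + 1) * Complex.exp (-(r * t)))
        ((k + 1) * ((t : ℂ) ^ k * Complex.exp (-(r * t))) -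
          r * ((t : ℂ) ^ (k + 1) * Complex.exp (-(r * t)))) t := by
      intro t _
      have h1 := (Complex.ofRealCLM.hasDerivAt (x := t)).pow (k + 1)
      have h2 := (((Complex.ofRealCLM.hasDerivAt (x := t)).const_mul r).neg).cexp
      convert! h1.mul h2 using 1
      simp
      ring
    have i1 := (integrableOn_pow_mul_cexp_neg_mul_Ioi k hr).const_mul ((k : ℂ) + 1)
    have i2 := (integrableOn_pow_mul_cexp_neg_mul_Ioi (k + 1) hr).const_mul r
    have hlim : Filter.Tendsto (fun t : ℝ ↦ (t : ℂ) ^ (k + 1) * Complex.exp (-(r * t)))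
        Filter.atTop (nhds 0) := by
      rw [tendsto_zero_iff_norm_tendsto_zero]
      have h := tendsto_rpow_mul_exp_neg_mul_atTop_nhds_zero ((k + 1 : ℕ) : ℝ) r.re hr
      refine h.congr' ?_
      filter_upwards [Filter.eventually_gt_atTop 0] with t ht
      rw [Real.rpow_natCast]
      simp [Complex.norm_exp, abs_of_pos ht]
    have h := integral_Ioi_of_hasDerivAt_of_tendsto' hd (i1.sub i2) hlim
    rw [integral_sub i1 i2, integral_const_mul, integral_const_mul, ih] at h
    simp only [Complex.ofReal_zero, ne_eq, Nat.succ_ne_zero, not_false_eq_true, zero_pow, zero_mul,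
      sub_zero] at h
    rw [eq_div_iff (pow_ne_zero _ hr0), pow_succ, mul_comm, mul_assoc, ← sub_eq_zero.1 h,
      Nat.factorial_succ]
    push_cast
    field_simp

lemma cexp_mul_batemanPoly_eq_sum (n : ℕ) (z : ℂ) (t : ℝ) :
    Complex.exp (-(z * t)) * ((batemanPoly n t * Real.exp (-t) : ℝ) : ℂ) =
      ∑ j ∈ Finset.range (n + 1),
        2 * (2 ^ j * (-1) ^ (n - j) * (n.choose j : ℂ)) / ((j + 1).factorial : ℂ) *
          ((t : ℂ) ^ (j + 1) * Complex.exp (-((1 + z) * t))) := by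
  have : Complex.exp (-((1 + z) * t)) = Complex.exp (-(z * t)) * Complex.exp (-t) := by
    rw [← Complex.exp_add]
    ring_nf
  rw [this, batemanPoly]
  push_cast
  rw [Finset.sum_mul, Finset.mul_sum]
  refine Finset.sum_congr rfl fun j _ ↦ ?_
  ring

lemma integrableOn_cexp_mul_batemanPoly (n : ℕ) {z : ℂ} (hz : -1 < z.re) :
    IntegrableOn (fun t : ℝ ↦ Complex.exp (-(z * t)) *
      ((batemanPoly n t * Real.exp (-t) : ℝ) : ℂ)) (Ioi 0) := by
  simp only [cexp_mul_batemanPoly_eq_sum]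
  refine integrable_finsetSum _ fun j _ ↦ Integrable.const_mul ?_ _
  exact integrableOn_pow_mul_cexp_neg_mul_Ioi (j + 1) (by simp; linarith)

lemma integral_cexp_mul_batemanPoly (n : ℕ) {z : ℂ} (hz : -1 < z.re) :
    ∫ t in Ioi (0 : ℝ), Complex.exp (-(z * t)) * ((batemanPoly n t * Real.exp (-t) : ℝ) : ℂ) =
      2 * (1 - z) ^ n / (1 + z) ^ (n + 2) := by
  have hre : 0 < (1 + z).re := by simp; linarith
  have h0 : 1 + z ≠ 0 := by
    intro h
    simp [h] at hre
  simp only [cexp_mul_batemanPoly_eq_sum]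
  rw [integral_finsetSum _ fun j _ ↦ Integrable.const_mul
    (integrableOn_pow_mul_cexp_neg_mul_Ioi (j + 1) hre) _]
  have e : (1 - z) = 2 + -(1 + z) := by ring
  rw [e, add_pow, Finset.mul_sum, Finset.sum_div]
  refine Finset.sum_congr rfl fun j hj ↦ ?_
  rw [integral_const_mul, integral_pow_mul_cexp_neg_mul_Ioi _ hre]
  obtain ⟨m, rfl⟩ := Nat.exists_eq_add_of_le (Nat.lt_succ_iff.1 (Finset.mem_range.1 hj))
  have hf : ((j + 1).factorial : ℂ) ≠ 0 := by exact_mod_cast (j + 1).factorial_ne_zero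
  rw [Nat.add_sub_cancel_left, neg_pow (1 + z)]
  field_simp
  ring

/-- The continuous extension by zero of `t ↦ batemanPoly n t * exp (-t)` from `t > 0`. -/
noncomputable def batemanExt (n : ℕ) (t : ℝ) : ℂ :=
  ((batemanPoly n (max t 0) * Real.exp (-t) : ℝ) : ℂ)

lemma continuous_batemanExt (n : ℕ) : Continuous (batemanExt n) := by
  have := continuous_batemanPoly n
  unfold batemanExt
  fun_prop

lemma batemanExt_eq_indicator (n : ℕ) :
    batemanExt n =
      (Ioi 0).indicator fun t : ℝ ↦ ((batemanPoly n t * Real.exp (-t) : ℝ) : ℂ) := by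
  ext t
  by_cases ht : 0 < t
  · rw [indicator_of_mem (mem_Ioi.2 ht), batemanExt, max_eq_left ht.le]
  · rw [indicator_of_notMem (by simpa using ht), batemanExt, max_eq_right (not_lt.1 ht),
      batemanPoly_zero]
    simp

lemma integrable_batemanExt (n : ℕ) : Integrable (batemanExt n) := by
  rw [batemanExt_eq_indicator, integrable_indicator_iff measurableSet_Ioi]
  simpa using integrableOn_cexp_mul_batemanPoly n (z := 0) (by simp)

lemma fourier_batemanExt (n : ℕ) (w : ℝ) :
    𝓕 (batemanExt n) w = 2 * (1 - ((2 * Real.pi * w : ℝ) : ℂ) * Complex.I) ^ n /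
      (1 + ((2 * Real.pi * w : ℝ) : ℂ) * Complex.I) ^ (n + 2) := by
  rw [← integral_cexp_mul_batemanPoly n (z := ((2 * Real.pi * w : ℝ) : ℂ) * Complex.I) (by simp),
    ← integral_indicator measurableSet_Ioi, Real.fourier_real_eq_integral_exp_smul,
    batemanExt_eq_indicator]
  congr 1
  ext t
  by_cases ht : 0 < t
  · rw [indicator_of_mem (mem_Ioi.2 ht), indicator_of_mem (mem_Ioi.2 ht), smul_eq_mul]
    congr 2
    push_cast
    ring
  · rw [indicator_of_notMem (by simpa using ht), indicator_of_notMem (by simpa using ht),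
      smul_zero]

lemma one_add_ofReal_mul_I_ne_zero (u : ℝ) : (1 + (u : ℂ) * Complex.I) ≠ 0 := by
  intro h
  simpa using congrArg Complex.re h

lemma integrable_fourier_batemanExt (n : ℕ) : Integrable (𝓕 (batemanExt n)) := by
  have h : Integrable fun u : ℝ ↦ 2 * (1 - (u : ℂ) * Complex.I) ^ n /
      (1 + (u : ℂ) * Complex.I) ^ (n + 2) := by
    refine (integrable_inv_one_add_sq.const_mul 2).mono' ?_ (.of_forall fun u ↦ ?_)
    · refine Continuous.aestronglyMeasurable ?_
      exact Continuous.div (by fun_prop) (by fun_prop)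
        fun u ↦ pow_ne_zero _ (one_add_ofReal_mul_I_ne_zero u)
    · have hn : ‖1 - (u : ℂ) * Complex.I‖ = ‖1 + (u : ℂ) * Complex.I‖ := by
        rw [← Complex.norm_conj]
        simp [sub_eq_add_neg]
      have hsq : ‖1 + (u : ℂ) * Complex.I‖ ^ 2 = 1 + u ^ 2 := by
        rw [Complex.sq_norm]
        simp [Complex.normSq_apply]
        ring
      have hpos : 0 < ‖1 + (u : ℂ) * Complex.I‖ := norm_pos_iff.2 (one_add_ofReal_mul_I_ne_zero u)
      rw [norm_div, norm_mul, norm_pow, norm_pow, hn, ← hsq]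
      apply le_of_eq
      simp only [Complex.norm_ofNat]
      field_simp
      ring
  have h2 := h.comp_mul_left' (R := 2 * Real.pi) (by positivity)
  refine h2.congr (.of_forall fun w ↦ ?_)
  simp only [fourier_batemanExt]

lemma integral_eq_integral_tan (g : ℝ → ℂ) :
    ∫ u, g u = ∫ θ in Ioo (-(Real.pi / 2)) (Real.pi / 2),
      (1 / Real.cos θ ^ 2) • g (Real.tan θ) := by
  have h := integral_image_eq_integral_abs_deriv_smul (s := Ioo (-(Real.pi / 2)) (Real.pi / 2))
    measurableSet_Ioo (fun θ hθ ↦ (Real.hasDerivAt_tan_of_mem_Ioo hθ).hasDerivWithinAt)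
    Real.injOn_tan g
  rw [Real.image_tan_Ioo, setIntegral_univ] at h
  rw [h]
  refine setIntegral_congr_fun measurableSet_Ioo fun θ _ ↦ ?_
  rw [abs_of_nonneg (by positivity)]

lemma cos_inv_sq_mul_rational_tan (n : ℕ) {θ : ℝ} (hθ : Real.cos θ ≠ 0) :
    ((1 / Real.cos θ ^ 2 : ℝ) : ℂ) * ((1 - (Real.tan θ : ℂ) * Complex.I) ^ n /
      (1 + (Real.tan θ : ℂ) * Complex.I) ^ (n + 2)) =
      Complex.exp (-(((2 * n + 2) * θ : ℝ) : ℂ) * Complex.I) := by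
  have hc : (Complex.cos θ) ≠ 0 := by exact_mod_cast hθ
  have h1 : 1 + (Real.tan θ : ℂ) * Complex.I = Complex.exp (θ * Complex.I) / Complex.cos θ := by
    rw [Complex.exp_mul_I, Complex.ofReal_tan, Complex.tan]
    field_simp
  have h2 : 1 - (Real.tan θ : ℂ) * Complex.I =
      (Complex.exp (θ * Complex.I))⁻¹ / Complex.cos θ := by
    rw [← Complex.exp_neg, ← neg_mul, Complex.exp_mul_I, Complex.ofReal_tan, Complex.tan,
      Complex.cos_neg, Complex.sin_neg]
    field_simp
    ring
  have h3 : Complex.exp (-(((2 * n + 2) * θ : ℝ) : ℂ) * Complex.I) =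
      (Complex.exp (θ * Complex.I))⁻¹ ^ (2 * n + 2) := by
    rw [← Complex.exp_neg, ← Complex.exp_nat_mul]
    push_cast
    ring_nf
  have he := Complex.exp_ne_zero (θ * Complex.I)
  rw [h1, h2, h3]
  push_cast
  simp only [div_pow, inv_pow]
  field_simp
  ring

lemma batemanExt_eq_integral (n : ℕ) (t : ℝ) :
    batemanExt n t = (1 / Real.pi : ℝ) * ∫ θ in Ioo (-(Real.pi / 2)) (Real.pi / 2),
      Complex.exp ((t * Real.tan θ - (2 * n + 2) * θ : ℝ) * Complex.I) := by
  have hinv := (integrable_batemanExt n).fourierInv_fourier_eq (integrable_fourier_batemanExt n)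
    (continuous_batemanExt n).continuousAt (v := t)
  rw [← hinv, Real.fourierInv_eq']
  set G : ℝ → ℂ := fun u ↦ Complex.exp ((t * u : ℝ) * Complex.I) *
    (2 * (1 - (u : ℂ) * Complex.I) ^ n / (1 + (u : ℂ) * Complex.I) ^ (n + 2)) with hG
  have e : ∀ w : ℝ, Complex.exp (((2 * Real.pi * inner ℝ w t : ℝ) : ℂ) * Complex.I) •
      𝓕 (batemanExt n) w = G (2 * Real.pi * w) := by
    intro w
    rw [fourier_batemanExt, smul_eq_mul, hG]
    congr 3
    simp
    ring
  simp only [e]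
  rw [Measure.integral_comp_mul_left, integral_eq_integral_tan, Complex.real_smul,
    abs_of_nonneg (by positivity)]
  have e2 : ∫ θ in Ioo (-(Real.pi / 2)) (Real.pi / 2), (1 / Real.cos θ ^ 2) • G (Real.tan θ) =
      ∫ θ in Ioo (-(Real.pi / 2)) (Real.pi / 2),
        2 * Complex.exp ((t * Real.tan θ - (2 * n + 2) * θ : ℝ) * Complex.I) := by
    refine setIntegral_congr_fun measurableSet_Ioo fun θ hθ ↦ ?_
    simp only [hG]
    rw [Complex.real_smul, Complex.ofReal_sub, sub_eq_add_neg (_ : ℂ) (((2 * n + 2) * θ : ℝ) : ℂ),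
      add_mul (_ : ℂ) _ Complex.I, Complex.exp_add, ← cos_inv_sq_mul_rational_tan n (Real.cos_pos_of_mem_Ioo hθ).ne']
    ring
  rw [e2, integral_const_mul, ← mul_assoc]
  congr 1
  push_cast
  ring

lemma measurable_real_tan : Measurable Real.tan := by
  rw [show Real.tan = fun x ↦ Real.sin x / Real.cos x from funext Real.tan_eq_sin_div_cos]
  fun_prop

lemma intervalIntegrable_cos_tan (ν x a b : ℝ) :
    IntervalIntegrable (fun θ ↦ Real.cos (x * Real.tan θ - ν * θ)) volume a b := by
  refine (intervalIntegrable_const (c := (1 : ℝ))).mono_fun' ?_ (.of_forall fun θ ↦ ?_)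
  · have := measurable_real_tan
    exact Measurable.aestronglyMeasurable (by fun_prop)
  · exact Real.abs_cos_le_one _

lemma batemanK_eq_integral_symm (ν x : ℝ) :
    batemanK ν x = (1 / Real.pi) *
      ∫ θ in Ioo (-(Real.pi / 2)) (Real.pi / 2), Real.cos (x * Real.tan θ - ν * θ) := by
  have hpi := Real.pi_pos
  rw [← integral_Ioc_eq_integral_Ioo, ← intervalIntegral.integral_of_le (by linarith),
    ← intervalIntegral.integral_add_adjacent_intervals (b := 0)
      (intervalIntegrable_cos_tan ν x _ _) (intervalIntegrable_cos_tan ν x _ _)]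
  have h := intervalIntegral.integral_comp_neg (a := 0) (b := Real.pi / 2)
    fun θ ↦ Real.cos (x * Real.tan θ - ν * θ)
  rw [neg_zero] at h
  rw [← h, batemanK]
  have e : ∀ θ, Real.cos (x * Real.tan (-θ) - ν * -θ) = Real.cos (x * Real.tan θ - ν * θ) := by
    intro θ
    rw [← Real.cos_neg, Real.tan_neg]
    ring_nf
  simp only [e]
  ring

lemma batemanK_two_mul_add_two (n : ℕ) {t : ℝ} (ht : 0 < t) :
    batemanK (2 * n + 2) t = batemanPoly n t * Real.exp (-t) := by
  have h := batemanExt_eq_integral n t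
  rw [batemanExt, max_eq_left ht.le] at h
  have h' := congrArg Complex.re h
  rw [Complex.ofReal_re, Complex.re_ofReal_mul] at h'
  rw [h', batemanK_eq_integral_symm, ← Complex.reCLM_apply,
    ← ContinuousLinearMap.integral_comp_comm]
  · simp only [Complex.reCLM_apply, Complex.exp_ofReal_mul_I_re]
  · refine Integrable.mono' (g := fun _ ↦ 1) (by simp) ?_ (.of_forall fun θ ↦ ?_)
    · have := measurable_real_tan
      exact Measurable.aestronglyMeasurable (by fun_prop)
    · rw [Complex.norm_exp_ofReal_mul_I]

theorem bateman_laplace (n : ℕ) (s : ℝ) (hs : -1 < s) :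
    ∫ t in Set.Ioi (0 : ℝ), Real.exp (-s * t) * batemanK (2 * n + 2) t =
      2 * (1 - s) ^ n / (s + 1) ^ (n + 2) := by
  have h := integral_cexp_mul_batemanPoly n (z := s) (by simpa using hs)
  apply Complex.ofReal_injective
  rw [← integral_complex_ofReal]
  push_cast
  rw [add_comm (s : ℂ), ← h]
  refine setIntegral_congr_fun measurableSet_Ioi fun t ht ↦ ?_
  simp only [batemanK_two_mul_add_two n ht]
  push_cast
  ring_nf
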